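/- arXiv:math/0701227 — 4 statements merged into one kernel-verified Lean document; each statement's English description precedes it below -/
import Mathlib

section
/- Let d ≥ 1 be an integer, h0 > 0, h_min > 0, and let P be the (d+1)×(d+1) real diagonal matrix with diagonal entries p₁, …, p_{d+1} > 0; let √P be the diagonal matrix with entries √p₁, …, √p_{d+1}. Let x, y > 0 and let η, B : ℝ^d → ℝ be differentiable functions satisfying |η(X)| ≤ x, |∂ᵢη(X)| ≤ x, |B(X)| ≤ y and |∂ᵢB(X)| ≤ y for all X ∈ ℝ^d and 1 ≤ i ≤ d, together with η(X) − B(X) + h0 ≥ h_min for all X. Then for every X ∈ ℝ^d, every z ∈ [−1, 0] and every V ∈ ℝ^{d+1}, one has ⟨V, P̲(X,z) V⟩ ≥ c₀(x,y) · ‖√P V‖², where c₀(x,y) = (h_min/(d+1)²) · min( 1, 1/(h_min·(x + h0 + y)), (min_{1≤i≤d} p_{d+1}/pᵢ)/(x+y)² ) and ⟨·,·⟩, ‖·‖ are the Euclidean inner product and norm on ℝ^{d+1}. -/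
open Matrix

noncomputable section

/-- The block matrix `[[δ·I_d, U], [0, 1]]`: top-left block `δ` times the `d×d`
identity, top-right column `U`, bottom row `(0,…,0,1)`. -/
def blockM (d : ℕ) (δ : ℝ) (U : Fin d → ℝ) : Matrix (Fin (d+1)) (Fin (d+1)) ℝ :=
  Matrix.of fun i j =>
    if hi : (i : ℕ) < d then
      if (j : ℕ) < d then (if (i : ℕ) = (j : ℕ) then δ else 0)
      else U ⟨i, hi⟩
    else
      if (j : ℕ) < d then 0 else 1

/-- The vector `U(X,z) = −(z+1)∇η(X) + z∇B(X)`. -/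
def Uvec (d : ℕ) (η B : (Fin d → ℝ) → ℝ) (X : Fin d → ℝ) (z : ℝ) : Fin d → ℝ :=
  fun i => -(z+1) * fderiv ℝ η X (Pi.single i 1) + z * fderiv ℝ B X (Pi.single i 1)

theorem blockM_mulVec_castSucc (d : ℕ) (δ : ℝ) (U : Fin d → ℝ) (V : Fin (d+1) → ℝ) (i : Fin d) :
    (blockM d δ U *ᵥ V) i.castSucc = δ * V i.castSucc + U i * V (Fin.last d) := by
  simp [blockM, Matrix.mulVec, dotProduct, Fin.sum_univ_castSucc, ← Fin.ext_iff]

theorem blockM_mulVec_last (d : ℕ) (δ : ℝ) (U : Fin d → ℝ) (V : Fin (d+1) → ℝ) :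
    (blockM d δ U *ᵥ V) (Fin.last d) = V (Fin.last d) := by
  simp [blockM, Matrix.mulVec, dotProduct, Fin.sum_univ_castSucc]

theorem dotProduct_transpose_mul_diagonal_mul_mulVec {n : Type*} [Fintype n] [DecidableEq n]
    (M : Matrix n n ℝ) (p V : n → ℝ) :
    V ⬝ᵥ (Mᵀ * Matrix.diagonal p * M) *ᵥ V = ∑ i, p i * (M *ᵥ V) i ^ 2 := by
  rw [Matrix.mul_assoc, ← Matrix.mulVec_mulVec, Matrix.dotProduct_mulVec, Matrix.vecMul_transpose,
    ← Matrix.mulVec_mulVec, dotProduct]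
  refine Finset.sum_congr rfl fun i _ => ?_
  rw [Matrix.mulVec_diagonal]
  ring

theorem diagonal_sqrt_mulVec_dotProduct_self {n : Type*} [Fintype n] [DecidableEq n]
    (p V : n → ℝ) (hp : ∀ i, 0 ≤ p i) :
    (Matrix.diagonal fun i => Real.sqrt (p i)) *ᵥ V
      ⬝ᵥ (Matrix.diagonal fun i => Real.sqrt (p i)) *ᵥ V = ∑ i, p i * V i ^ 2 := by
  refine Finset.sum_congr rfl fun i _ => ?_
  rw [Matrix.mulVec_diagonal]
  linear_combination V i ^ 2 * Real.mul_self_sqrt (hp i)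

/-- A convex combination of the two gradients is bounded by the sum of the bounds. -/
theorem sq_convex_combination_le {x y z a b : ℝ} (hz : z ∈ Set.Icc (-1 : ℝ) 0)
    (ha : |a| ≤ x) (hb : |b| ≤ y) : (-(z + 1) * a + z * b) ^ 2 ≤ (x + y) ^ 2 := by
  obtain ⟨hz1, hz0⟩ := hz
  obtain ⟨ha1, ha2⟩ := abs_le.1 ha
  obtain ⟨hb1, hb2⟩ := abs_le.1 hb
  refine sq_le_sq' ?_ ?_ <;> nlinarith

/-- Coercivity of the quadratic form attached to `blockM`, in coordinates. -/
theorem blockM_form_coercive {d : ℕ} {δ h t r w : ℝ} {q v u : Fin d → ℝ}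
    (hd : 1 ≤ d) (hq : ∀ i, 0 ≤ q i) (hr : 0 ≤ r) (hh : 0 < h) (hδ : h ≤ δ) (ht : 0 ≤ t)
    (ht1 : t ≤ 1) (htδ : t * (h * δ) ≤ 1) (htu : ∀ i, t * (q i * u i ^ 2) ≤ r) :
    h / ((d : ℝ) + 1) ^ 2 * t * (∑ i, q i * v i ^ 2 + r * w ^ 2)
      ≤ δ⁻¹ * (∑ i, q i * (δ * v i + u i * w) ^ 2 + r * w ^ 2) := by
  have hδ0 : 0 < δ := hh.trans_le hδ
  have hdR : (1 : ℝ) ≤ d := by exact_mod_cast hd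
  have key : t * δ ^ 2 * ∑ i, q i * v i ^ 2
      ≤ 2 * ∑ i, q i * (δ * v i + u i * w) ^ 2 + d * (2 * (r * w ^ 2)) := by
    have hsum : ∑ i, t * δ ^ 2 * (q i * v i ^ 2)
        ≤ ∑ i, (2 * (q i * (δ * v i + u i * w) ^ 2) + 2 * (r * w ^ 2)) := by
      refine Finset.sum_le_sum fun i _ => ?_
      have h1 : 0 ≤ t * q i * (δ * v i + 2 * (u i * w)) ^ 2 :=
        mul_nonneg (mul_nonneg ht (hq i)) (sq_nonneg _)
      have h2 := mul_le_mul_of_nonneg_right (htu i) (sq_nonneg w)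
      have h3 := mul_le_mul_of_nonneg_right ht1
        (mul_nonneg (hq i) (sq_nonneg (δ * v i + u i * w)))
      linarith
    simpa [Finset.sum_add_distrib, ← Finset.mul_sum] using hsum
  have hS : 0 ≤ ∑ i, q i * v i ^ 2 :=
    Finset.sum_nonneg fun i _ => mul_nonneg (hq i) (sq_nonneg _)
  have hQ : 0 ≤ ∑ i, q i * (δ * v i + u i * w) ^ 2 :=
    Finset.sum_nonneg fun i _ => mul_nonneg (hq i) (sq_nonneg _)
  have hR : 0 ≤ r * w ^ 2 := mul_nonneg hr (sq_nonneg _)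
  generalize (∑ i, q i * v i ^ 2) = S at *
  generalize (∑ i, q i * (δ * v i + u i * w) ^ 2) = Q at *
  generalize r * w ^ 2 = R at *
  have h1 : t * (h * δ) * S ≤ t * δ ^ 2 * S := by
    rw [sq]; gcongr
  have h2 : t * (h * δ) * R ≤ R := mul_le_of_le_one_left hR htδ
  rw [div_mul_eq_mul_div, div_mul_eq_mul_div, inv_mul_eq_div, div_le_div_iff₀ (by positivity) hδ0]
  nlinarith [mul_nonneg (sub_nonneg.2 hdR) hQ, mul_nonneg (sq_nonneg (d : ℝ)) hQ,
    mul_nonneg (sq_nonneg (d : ℝ)) hR]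

/-- Lemma 1 (coercivity of `P̲`): for `z ∈ [−1,0]` and every `V ∈ ℝ^{d+1}`,
`⟨V, P̲(X,z) V⟩ ≥ c₀(x,y) ‖√P V‖²` where
`P̲(X,z) = δ(X)⁻¹ Mᵀ P M`, `δ(X) = η(X) + h0 − B(X)`,
`M = [[δ I_d, U(X,z)],[0,1]]`, and
`c₀(x,y) = hmin/(d+1)² · min(1, 1/(hmin(x+h0+y)), (min_i p_{d+1}/p_i)/(x+y)²)`. -/
theorem coercivity_of_P_underline
    (d : ℕ) (hd : 1 ≤ d) (h0 hmin : ℝ) (hh0 : 0 < h0) (hhmin : 0 < hmin)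
    (p : Fin (d+1) → ℝ) (hp : ∀ i, 0 < p i)
    (x y : ℝ) (hx : 0 < x) (hy : 0 < y)
    (η B : (Fin d → ℝ) → ℝ) (hη : Differentiable ℝ η) (hB : Differentiable ℝ B)
    (hηval : ∀ X, |η X| ≤ x)
    (hηder : ∀ X (i : Fin d), |fderiv ℝ η X (Pi.single i 1)| ≤ x)
    (hBval : ∀ X, |B X| ≤ y)
    (hBder : ∀ X (i : Fin d), |fderiv ℝ B X (Pi.single i 1)| ≤ y)
    (hdepth : ∀ X, η X - B X + h0 ≥ hmin)
    (X : Fin d → ℝ) (z : ℝ) (hz : z ∈ Set.Icc (-1 : ℝ) 0)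
    (V : Fin (d+1) → ℝ) :
    V ⬝ᵥ ((η X + h0 - B X)⁻¹ •
        ((blockM d (η X + h0 - B X) (Uvec d η B X z))ᵀ
          * Matrix.diagonal p
          * blockM d (η X + h0 - B X) (Uvec d η B X z))).mulVec V
    ≥ (hmin / ((d : ℝ) + 1)^2
        * min 1 (min (1 / (hmin * (x + h0 + y)))
            ((⨅ i : Fin d, p (Fin.last d) / p (Fin.castSucc i)) / (x + y)^2)))
      * ((Matrix.diagonal fun i => Real.sqrt (p i)).mulVec V
          ⬝ᵥ (Matrix.diagonal fun i => Real.sqrt (p i)).mulVec V) := by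
  obtain ⟨-, hη2⟩ := abs_le.1 (hηval X)
  obtain ⟨hB1, -⟩ := abs_le.1 (hBval X)
  have hδ : hmin ≤ η X + h0 - B X := by linarith [hdepth X]
  have hδD : η X + h0 - B X ≤ x + h0 + y := by linarith
  rw [ge_iff_le, Matrix.smul_mulVec, dotProduct_smul, smul_eq_mul,
    dotProduct_transpose_mul_diagonal_mul_mulVec,
    diagonal_sqrt_mulVec_dotProduct_self p V fun i => (hp i).le,
    Fin.sum_univ_castSucc, Fin.sum_univ_castSucc]
  simp only [blockM_mulVec_castSucc, blockM_mulVec_last]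
  have hxy : 0 < x + y := by positivity
  have hm : 0 ≤ ⨅ i : Fin d, p (Fin.last d) / p (Fin.castSucc i) :=
    Real.iInf_nonneg fun i => (div_pos (hp _) (hp _)).le
  refine blockM_form_coercive hd (fun i => (hp _).le) (hp _).le hhmin hδ
    (by positivity) (min_le_left _ _) ?_ fun i => ?_
  · calc _ ≤ 1 / (hmin * (x + h0 + y)) * (hmin * (x + h0 + y)) := by
          gcongr
          · exact mul_nonneg hhmin.le (hhmin.le.trans hδ)
          · exact (min_le_right _ _).trans (min_le_left _ _)
      _ = 1 := one_div_mul_cancel (by positivity)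
  · have hpi := hp i.castSucc
    have hinf : (⨅ i : Fin d, p (Fin.last d) / p (Fin.castSucc i))
        ≤ p (Fin.last d) / p i.castSucc := ciInf_le (Set.finite_range _).bddBelow i
    have hU : Uvec d η B X z i ^ 2 ≤ (x + y) ^ 2 :=
      sq_convex_combination_le hz (hηder X i) (hBder X i)
    calc _ ≤ p (Fin.last d) / p i.castSucc / (x + y) ^ 2 * (p i.castSucc * (x + y) ^ 2) := by
          refine mul_le_mul ?_ ?_ (mul_nonneg hpi.le (sq_nonneg _)) ?_
          · refine (min_le_right _ _).trans ((min_le_right _ _).trans ?_)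
            gcongr
          · exact mul_le_mul_of_nonneg_left hU hpi.le
          · exact div_nonneg (div_pos (hp _) hpi).le (sq_nonneg _)
      _ = p (Fin.last d) := by field_simp
end
end

section
/- Let d ≥ 1, let f : ℝ^d → ℝ be four times continuously differentiable, and let η, b : ℝ^d → ℝ with b differentiable. Define u₁(X,z) = (1/2 − (z+1)²/2)·Δf(X) and u₂(X,z) = ((z+1)⁴/24 − (z+1)²/4 + 5/24)·Δ²f(X) + (1 − (z+1)²)·(η(X) − b(X))·Δf(X) + z·∇b(X)·∇f(X), where Δ²f = Δ(Δf). Then for all (X,z) ∈ ℝ^d × [−1,0]: (i) ∂_z²u₂(X,z) + Δ_X u₁(X,z) − (η(X) − b(X))·∂_z²u₁(X,z) + (η(X) − b(X))·Δf(X) = 0; (ii) u₂(X,0) = 0; (iii) ∂_z u₂(X,−1) − ∇b(X)·∇f(X) = 0. -/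
noncomputable section

/-- The Laplacian `Δf(X) = Σ_{i=1}^d ∂ᵢ²f(X)` of `f : ℝ^d → ℝ`. -/
def lap (d : ℕ) (f : (Fin d → ℝ) → ℝ) (X : Fin d → ℝ) : ℝ :=
  ∑ i : Fin d, fderiv ℝ (fun Y => fderiv ℝ f Y (Pi.single i 1)) X (Pi.single i 1)

/-- The inner product of gradients `∇b·∇f (X) = Σ_i ∂ᵢb(X) ∂ᵢf(X)`. -/
def gradDot (d : ℕ) (b f : (Fin d → ℝ) → ℝ) (X : Fin d → ℝ) : ℝ :=
  ∑ i : Fin d, fderiv ℝ b X (Pi.single i 1) * fderiv ℝ f X (Pi.single i 1)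

/-- `u₁(X,z) = (1/2 − (z+1)²/2)·Δf(X)`. -/
def u1 (d : ℕ) (f : (Fin d → ℝ) → ℝ) (X : Fin d → ℝ) (z : ℝ) : ℝ :=
  (1/2 - (z+1)^2/2) * lap d f X

/-- `u₂(X,z) = ((z+1)⁴/24 − (z+1)²/4 + 5/24)·Δ²f(X)
      + (1 − (z+1)²)·(η(X) − b(X))·Δf(X) + z·∇b(X)·∇f(X)`. -/
def u2 (d : ℕ) (f η b : (Fin d → ℝ) → ℝ) (X : Fin d → ℝ) (z : ℝ) : ℝ :=
  ((z+1)^4/24 - (z+1)^2/4 + 5/24) * lap d (lap d f) X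
    + (1 - (z+1)^2) * (η X - b X) * lap d f X
    + z * gradDot d b f X

/-- The Laplacian is homogeneous; no differentiability of `g` is needed. -/
theorem lap_const_mul (d : ℕ) (c : ℝ) (g : (Fin d → ℝ) → ℝ) (X : Fin d → ℝ) :
    lap d (fun Y => c * g Y) X = c * lap d g X := by
  have key : ∀ (h : (Fin d → ℝ) → ℝ) (Y : Fin d → ℝ),
      fderiv ℝ (fun Y => c * h Y) Y = c • fderiv ℝ h Y := fun h Y =>
    congrFun (fderiv_const_smul_field (𝕜 := ℝ) (f := h) c) Y
  simp only [lap, key, _root_.smul_apply, smul_eq_mul, Finset.mul_sum]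

theorem deriv_u1 (d : ℕ) (f : (Fin d → ℝ) → ℝ) (X : Fin d → ℝ) :
    deriv (fun w : ℝ => u1 d f X w) = fun w => -(w + 1) * lap d f X := by
  funext w
  have h : HasDerivAt (fun w : ℝ => w + 1) 1 w := (hasDerivAt_id w).add_const 1
  have h1 := (((h.pow 2).div_const 2).const_sub (1 / 2)).mul_const (lap d f X)
  refine (h1.congr_deriv ?_).deriv
  push_cast
  ring

theorem deriv_deriv_u1 (d : ℕ) (f : (Fin d → ℝ) → ℝ) (X : Fin d → ℝ) (z : ℝ) :
    deriv (deriv (fun w : ℝ => u1 d f X w)) z = -lap d f X := by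
  rw [deriv_u1]
  have h : HasDerivAt (fun w : ℝ => w + 1) 1 z := (hasDerivAt_id z).add_const 1
  refine ((h.neg.mul_const (lap d f X)).congr_deriv ?_).deriv
  ring

theorem deriv_u2 (d : ℕ) (f η b : (Fin d → ℝ) → ℝ) (X : Fin d → ℝ) :
    deriv (fun w : ℝ => u2 d f η b X w) = fun w =>
      ((w + 1) ^ 3 / 6 - (w + 1) / 2) * lap d (lap d f) X
        + -(w + 1) * (2 * (η X - b X) * lap d f X) + gradDot d b f X := by
  funext w
  have h : HasDerivAt (fun w : ℝ => w + 1) 1 w := (hasDerivAt_id w).add_const 1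
  have h1 := (((((h.pow 4).div_const 24).sub ((h.pow 2).div_const 4)).add_const
    (5 / 24)).mul_const (lap d (lap d f) X)).add
    ((((h.pow 2).const_sub 1).mul_const (η X - b X)).mul_const (lap d f X))
  refine ((h1.add ((hasDerivAt_id w).mul_const (gradDot d b f X))).congr_deriv ?_).deriv
  push_cast
  ring

theorem deriv_deriv_u2 (d : ℕ) (f η b : (Fin d → ℝ) → ℝ) (X : Fin d → ℝ) (z : ℝ) :
    deriv (deriv (fun w : ℝ => u2 d f η b X w)) z =
      ((z + 1) ^ 2 / 2 - 1 / 2) * lap d (lap d f) X - 2 * (η X - b X) * lap d f X := by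
  rw [deriv_u2]
  have h : HasDerivAt (fun w : ℝ => w + 1) 1 z := (hasDerivAt_id z).add_const 1
  have h1 := ((((h.pow 3).div_const 6).sub (h.div_const 2)).mul_const
    (lap d (lap d f) X)).add (h.neg.mul_const (2 * (η X - b X) * lap d f X))
  refine ((h1.add_const (gradDot d b f X)).congr_deriv ?_).deriv
  push_cast
  ring

/-- Second step of the WKB cascade (small bottom-variation regime): with
`u₁, u₂` as above, for all `(X,z) ∈ ℝ^d × [−1,0]` one has
(i) `∂_z²u₂ + Δ_X u₁ − (η−b)·∂_z²u₁ + (η−b)·Δf = 0`;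
(ii) `u₂(X,0) = 0`; (iii) `∂_z u₂(X,−1) − ∇b·∇f(X) = 0`. -/
theorem wkb_second_order
    (d : ℕ) (hd : 1 ≤ d) (f : (Fin d → ℝ) → ℝ) (hf : ContDiff ℝ 4 f)
    (η b : (Fin d → ℝ) → ℝ) (hb : Differentiable ℝ b)
    (X : Fin d → ℝ) (z : ℝ) (hz : z ∈ Set.Icc (-1 : ℝ) 0) :
    deriv (deriv (fun w : ℝ => u2 d f η b X w)) z
        + lap d (fun Y => u1 d f Y z) X
        - (η X - b X) * deriv (deriv (fun w : ℝ => u1 d f X w)) z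
        + (η X - b X) * lap d f X = 0 ∧
    u2 d f η b X 0 = 0 ∧
    deriv (fun w : ℝ => u2 d f η b X w) (-1) - gradDot d b f X = 0 := by
  refine ⟨?_, ?_, ?_⟩
  · have hl : lap d (fun Y => u1 d f Y z) X = (1/2 - (z+1)^2/2) * lap d (lap d f) X :=
      lap_const_mul d _ (lap d f) X
    rw [deriv_deriv_u2, deriv_deriv_u1, hl]
    ring
  · simp only [u2]
    ring
  · rw [deriv_u2]
    ring
end
end

section
/- Let d ≥ 1, let f : ℝ^d → ℝ be four times continuously differentiable, let η, b : ℝ^d → ℝ with b differentiable, and let ε ∈ ℝ. Set w = η − b, Z₁ = −Δf, Z₂ = −(1/3)Δ²f − (η − b)Δf + ∇b·∇f, and define u_app(X,z) = u₀(X,z) + ε·u₁(X,z) + ε²·u₂(X,z), where u₀(X,z) = f(X), u₁(X,z) = (1/2 − (z+1)²/2)·Δf(X), and u₂(X,z) = ((z+1)⁴/24 − (z+1)²/4 + 5/24)·Δ²f(X) + (1 − (z+1)²)·(η(X) − b(X))·Δf(X) + z·∇b(X)·∇f(X). Then for every X ∈ ℝ^d one has the exact identity ∂_z u_app(X,0)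 = (1 + ε·w(X))·(ε·Z₁(X) + ε²·Z₂(X)) − ε³·w(X)·Z₂(X). In particular, wherever 1 + ε·w(X) ≠ 0, the difference (1 + ε·w(X))⁻¹·∂_z u_app(X,0) − (ε·Z₁(X) + ε²·Z₂(X)) equals −ε³·w(X)·Z₂(X)/(1 + ε·w(X)). -/
noncomputable section

/-- `Z₁ = −Δf`. -/
def Z1 (d : ℕ) (f : (Fin d → ℝ) → ℝ) (X : Fin d → ℝ) : ℝ := -(lap d f X)

/-- `Z₂ = −(1/3)Δ²f − (η−b)Δf + ∇b·∇f`. -/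
def Z2 (d : ℕ) (f η b : (Fin d → ℝ) → ℝ) (X : Fin d → ℝ) : ℝ :=
  -(1/3) * lap d (lap d f) X - (η X - b X) * lap d f X + gradDot d b f X

/-- `u_app = u₀ + ε u₁ + ε² u₂`. -/
def uapp (d : ℕ) (ε : ℝ) (f η b : (Fin d → ℝ) → ℝ) (X : Fin d → ℝ) (z : ℝ) : ℝ :=
  f X + ε * u1 d f X z + ε^2 * u2 d f η b X z

/-- The vertical derivative of the approximate solution at the surface. -/
theorem hasDerivAt_uapp_zero (d : ℕ) (ε : ℝ) (f η b : (Fin d → ℝ) → ℝ) (X : Fin d → ℝ) :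
    HasDerivAt (fun z : ℝ => uapp d ε f η b X z)
      (ε * Z1 d f X + ε^2 * (Z2 d f η b X + (η X - b X) * Z1 d f X)) 0 := by
  have h1 : HasDerivAt (fun z : ℝ => z + 1) 1 0 := (hasDerivAt_id (0 : ℝ)).add_const 1
  have h2 := h1.pow 2
  have h4 := h1.pow 4
  have hu1 := ((h2.div_const 2).const_sub (1/2)).mul_const (lap d f X)
  have hu2 := (((((h4.div_const 24).sub (h2.div_const 4)).add_const (5/24)).mul_const
    (lap d (lap d f) X)).add (((h2.const_sub 1).mul_const (η X - b X)).mul_const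
    (lap d f X))).add ((hasDerivAt_id (0 : ℝ)).mul_const (gradDot d b f X))
  have h := ((hu1.const_mul ε).const_add (f X)).add (hu2.const_mul (ε^2))
  refine h.congr_deriv ?_
  simp only [Z1, Z2]
  push_cast
  ring

/-- Exact identity for the vertical derivative of the WKB approximate solution at
the surface `z = 0`, with `w = η − b`:
`∂_z u_app(X,0) = (1 + εw)(εZ₁ + ε²Z₂) − ε³ w Z₂`; in particular, wherever
`1 + εw(X) ≠ 0`,
`(1 + εw)⁻¹ ∂_z u_app(X,0) − (εZ₁ + ε²Z₂) = −ε³ w Z₂/(1 + εw)`. -/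
theorem uapp_deriv_surface
    (d : ℕ) (hd : 1 ≤ d) (f : (Fin d → ℝ) → ℝ) (hf : ContDiff ℝ 4 f)
    (η b : (Fin d → ℝ) → ℝ) (hb : Differentiable ℝ b) (ε : ℝ) :
    ∀ X : Fin d → ℝ,
      deriv (fun z : ℝ => uapp d ε f η b X z) 0
          = (1 + ε * (η X - b X)) * (ε * Z1 d f X + ε^2 * Z2 d f η b X)
            - ε^3 * (η X - b X) * Z2 d f η b X ∧
      (1 + ε * (η X - b X) ≠ 0 →
        (1 + ε * (η X - b X))⁻¹ * deriv (fun z : ℝ => uapp d ε f η b X z) 0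
            - (ε * Z1 d f X + ε^2 * Z2 d f η b X)
          = -(ε^3 * (η X - b X) * Z2 d f η b X) / (1 + ε * (η X - b X))) := by
  intro X
  have key : deriv (fun z : ℝ => uapp d ε f η b X z) 0
      = (1 + ε * (η X - b X)) * (ε * Z1 d f X + ε^2 * Z2 d f η b X)
        - ε^3 * (η X - b X) * Z2 d f η b X := by
    rw [(hasDerivAt_uapp_zero d ε f η b X).deriv]
    ring
  refine ⟨key, fun hw => ?_⟩
  rw [key, mul_sub, inv_mul_cancel_left₀ hw]
  ring
end
end

section
/- There exist real numbers θ, λ₁, λ₂, μ with θ ∈ [0,1] satisfying simultaneously the four equations: (1) λ₁(1−θ²) = μ(θ² − 1/3); (2) (1−θ)·(2λ₂ − (3/2)λ₁(1+θ)) = −μ·((3/2)θ² − 7/6); (3) (λ₁/2)(1−θ²) = −θ²/2 + 2θ − 7/6; (4) (1−θ)·(λ₂ − (λ₁/2)(1+θ)) = −(1/2)(θ−2)². (One solution has approximate values θ ≈ 0.6318, λ₁ ≈ −0.3416, λ₂ ≈ −2.8209, μ ≈ −3.1157.) -/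
/-- Eliminating `λ₁, λ₂, μ` from the symmetrization conditions leaves a quartic equation in `θ`,
which has a root in `[3/5, 7/10]`. -/
theorem exists_root_symmetrization_quartic :
    ∃ θ ∈ Set.Icc (3 / 5 : ℝ) (7 / 10),
      ((-θ^2 + 4*θ - 7/3) / 2 + (θ-2)^2) * (θ^2 - 1/3)
        - (-θ^2 + 4*θ - 7/3) * ((3/2)*θ^2 - 7/6) = 0 := by
  refine intermediate_value_Icc (by norm_num) (f := fun θ : ℝ =>
    ((-θ^2 + 4*θ - 7/3) / 2 + (θ-2)^2) * (θ^2 - 1/3)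
      - (-θ^2 + 4*θ - 7/3) * ((3/2)*θ^2 - 7/6)) (by fun_prop) ?_
  norm_num

/-- Existence of a fully symmetric system in the strong bottom-variation regime:
there exist `θ ∈ [0,1]` and real parameters `λ₁, λ₂, μ` satisfying the four
symmetrization conditions `b₁ = c₁`, `b₂ = −c₂`, `b₃ = c₃`, `b₄ = −c₄`.
(One solution has `θ ≈ 0.6318`, `λ₁ ≈ −0.3416`, `λ₂ ≈ −2.8209`, `μ ≈ −3.1157`.) -/
theorem exists_symmetric_parameters :
    ∃ θ lam1 lam2 mu : ℝ, θ ∈ Set.Icc (0 : ℝ) 1 ∧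
      lam1 * (1 - θ^2) = mu * (θ^2 - 1/3) ∧
      (1 - θ) * (2*lam2 - (3/2)*lam1*(1+θ)) = -(mu * ((3/2)*θ^2 - 7/6)) ∧
      (lam1/2) * (1 - θ^2) = -θ^2/2 + 2*θ - 7/6 ∧
      (1 - θ) * (lam2 - (lam1/2)*(1+θ)) = -(1/2) * (θ-2)^2 := by
  obtain ⟨θ, ⟨hl, hu⟩, h⟩ := exists_root_symmetrization_quartic
  have h₁ : 1 - θ ≠ 0 := ne_of_gt (by linarith)
  have h₂ : 1 - θ^2 ≠ 0 := ne_of_gt (by nlinarith)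
  have h₃ : θ^2 - 1/3 ≠ 0 := ne_of_gt (by nlinarith)
  obtain ⟨a, ha⟩ : ∃ a, a * (1 - θ^2) = -θ^2 + 4*θ - 7/3 := ⟨_, div_mul_cancel₀ _ h₂⟩
  obtain ⟨b, hb⟩ : ∃ b, b * (1 - θ) = (-θ^2 + 4*θ - 7/3) / 2 - (θ-2)^2 / 2 :=
    ⟨_, div_mul_cancel₀ _ h₁⟩
  obtain ⟨m, hm⟩ : ∃ m, m * (θ^2 - 1/3) = -θ^2 + 4*θ - 7/3 := ⟨_, div_mul_cancel₀ _ h₃⟩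
  refine ⟨θ, a, b, m, ⟨by linarith, by linarith⟩, by linarith, ?_, by linarith, by linarith⟩
  have key : (-θ^2 + 4*θ - 7/3) / 2 + (θ-2)^2 = m * ((3/2)*θ^2 - 7/6) :=
    mul_right_cancel₀ h₃ (by linear_combination h - ((3/2)*θ^2 - 7/6) * hm)
  linear_combination 2 * hb - 3/2 * ha - key
end
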